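/- Let P be an FLC, well-separated, expansive L-sub pattern with predecessor P', and let (P_i)_{i∈ℤ} be a hierarchy for P, i.e., a bi-infinite sequence of patterns with σ(P_{i+1}) = P_i for all i ∈ ℤ, P₀ = P and P₁ = P'. Then all the P_i are pairwise locally isomorphic, and each P_i is L-sub with predecessor P_{i+1}. -/

import Mathlib

open Metric Set Filter Topology Pointwise

variable {E : Type*} [NormedAddCommGroup E] [NormedSpace ℝ E] {S : Type*}

/-- Equality of the `U`-patches of the pattern `P` at `x` and of `Q` at `y`:
`P[x,U] = Q[y,U]`. -/
def PatchEq (P Q : E → S) (x y : E) (U : Set E) : Prop :=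
  ∀ u ∈ U, P (x + u) = Q (y + u)

/-- The translate `P + z` of a pattern `P`. -/
def transl (z : E) (P : E → S) : E → S := fun x => P (x - z)

/-- The distortion `L P` of a pattern `P` by a linear automorphism `L`. -/
def distort (L : E ≃ₗ[ℝ] E) (P : E → S) : E → S := fun x => P (L.symm x)

/-- `Q` is locally indistinguishable from `P` (`Q ≼ P`). -/
def LIfrom (Q P : E → S) : Prop :=
  ∀ U : Set E, IsCompact U → ∀ x : E, ∃ y : E, PatchEq Q P x y U

/-- `P` and `Q` are locally isomorphic (`P ≈ Q`). -/
def LocIso (P Q : E → S) : Prop :=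
  LIfrom P Q ∧ LIfrom Q P

/-- `Q` is locally derivable from `P` (`P ⊳ Q`). -/
def LD (P Q : E → S) : Prop :=
  ∃ c : ℝ, 0 ≤ c ∧ ∀ x y : E, PatchEq P P x y (closedBall 0 c) → Q x = Q y

/-- The group of translational periods of a pattern: `{g | P + g = P}`. -/
def periods (P : E → S) : AddSubgroup E where
  carrier := {g : E | ∀ x : E, P (x + g) = P x}
  zero_mem' := by intro x; rw [add_zero]
  add_mem' := by
    intro a b ha hb
    simp only [Set.mem_setOf_eq] at ha hb ⊢
    intro x
    rw [← add_assoc, hb, ha]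
  neg_mem' := by
    intro a ha
    simp only [Set.mem_setOf_eq] at ha ⊢
    intro x
    have h := ha (x + -a)
    have h2 : x + -a + a = x := by abel
    rw [h2] at h
    exact h.symm

/-- Finite local complexity (FLC) for a single pattern. -/
def IsFLC (P : E → S) : Prop :=
  ∀ U : Set E, IsCompact U → ∃ K : Set E, IsCompact K ∧ ∀ x : E, ∃ v ∈ K, PatchEq P P x v U

/-- Repetitivity for a single pattern. -/
def Repetitive (P : E → S) : Prop :=
  ∀ U : Set E, IsCompact U →
    ∃ R : Set E, IsCompact R ∧ ∀ x y : E, ∃ v ∈ R, PatchEq P P x (y + v) U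

/-- Well-separation for a single pattern. -/
def WellSeparated (P : E → S) : Prop :=
  ∃ V : Set E, IsCompact V ∧ ∀ x y : E, P x ≠ P y →
    ∃ B ∈ 𝓝 (0 : E), ∀ b ∈ B, ∀ b' ∈ B, ¬ PatchEq P P (x + b) (y + b') V

/-- Return discreteness for a single pattern. -/
def ReturnDiscrete (P : E → S) : Prop :=
  ∃ B ∈ 𝓝 (0 : E), ∃ V : Set E, IsCompact V ∧
    ∀ x : E, ∀ b ∈ B, PatchEq P P x (x + b) V → b = 0

/-- The translational hull of a pattern: all patterns locally indistinguishable from it. -/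
def patternHull (P : E → S) : Set (E → S) := {Q | LIfrom Q P}

/-- A pattern space: a nonempty set of patterns closed under being locally
indistinguishable from the collection. -/
def IsPatternSpace (Ω : Set (E → S)) : Prop :=
  Ω.Nonempty ∧ ∀ Q : E → S,
    (∀ U : Set E, IsCompact U → ∀ x : E, ∃ R ∈ Ω, ∃ y : E, PatchEq Q R x y U) → Q ∈ Ω

/-- Finite local complexity for a pattern space. -/
def IsFLCSpace (Ω : Set (E → S)) : Prop :=
  ∀ U : Set E, IsCompact U → ∃ (n : ℕ) (Ps : Fin n → E → S) (Ks : Fin n → Set E),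
    (∀ i, IsCompact (Ks i)) ∧ ∀ Q ∈ Ω, ∀ x : E, ∃ i, ∃ y ∈ Ks i, PatchEq Q (Ps i) x y U

/-- Well-separation for a pattern space. -/
def WellSeparatedSpace (Ω : Set (E → S)) : Prop :=
  ∃ V : Set E, IsCompact V ∧ ∀ P ∈ Ω, ∀ Q ∈ Ω, P 0 ≠ Q 0 →
    ∃ B ∈ 𝓝 (0 : E), ∀ b ∈ B, ∀ b' ∈ B, ¬ PatchEq P Q b b' V

/-- Return discreteness for a pattern space. -/
def ReturnDiscreteSpace (Ω : Set (E → S)) : Prop :=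
  ∃ B ∈ 𝓝 (0 : E), ∃ V : Set E, IsCompact V ∧
    ∀ P ∈ Ω, ∀ b ∈ B, PatchEq P P 0 b V → b = 0

/-- Repetitivity for a pattern space. -/
def RepetitiveSpace (Ω : Set (E → S)) : Prop :=
  ∀ U : Set E, IsCompact U → ∃ R : Set E, IsCompact R ∧
    ∀ P ∈ Ω, ∀ Q ∈ Ω, ∃ v ∈ R, PatchEq P Q 0 v U

/-- A local derivation (LD) map between two sets of patterns. -/
def IsLDMapOn (f : (E → S) → (E → S)) (Ω Ω' : Set (E → S)) : Prop :=
  Set.MapsTo f Ω Ω' ∧ ∃ c : ℝ, 0 ≤ c ∧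
    ∀ P ∈ Ω, ∀ Q ∈ Ω, ∀ x y : E, PatchEq P Q x y (closedBall 0 c) → f P x = f Q y

/-- An expansive linear automorphism (all eigenvalues of modulus strictly greater
than `1`; equivalently, iterates expand uniformly at an exponential rate). -/
def IsExpansive (L : E ≃ₗ[ℝ] E) : Prop :=
  ∃ C > (0 : ℝ), ∃ l > (1 : ℝ), ∀ (n : ℕ) (x : E), C * l ^ n * ‖x‖ ≤ ‖(L ^ n : E ≃ₗ[ℝ] E) x‖

/-- `P` is `L`-sub with predecessor `P'`: `P' ≼ P` and `L P' ⊳ P`. -/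
def IsLSub (L : E ≃ₗ[ℝ] E) (P P' : E → S) : Prop :=
  LIfrom P' P ∧ LD (distort L P') P

/-- An `L`-sub pattern space: `Ω` together with a surjective LD (subdivision) map
`S : L Ω → Ω`. -/
def IsLSubSpace (L : E ≃ₗ[ℝ] E) (Ω : Set (E → S)) (Sub : (E → S) → (E → S)) : Prop :=
  IsLDMapOn Sub (distort L '' Ω) Ω ∧ Set.SurjOn Sub (distort L '' Ω) Ω

/-- The substitution map `σ := S ∘ L`. -/
def substMap (L : E ≃ₗ[ℝ] E) (Sub : (E → S) → (E → S)) : (E → S) → (E → S) :=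
  fun Q => Sub (distort L Q)


theorem PatchEq.trans {P Q R : E → S} {x y z : E} {U : Set E}
    (h : PatchEq P Q x y U) (h' : PatchEq Q R y z U) : PatchEq P R x z U :=
  fun u hu => (h u hu).trans (h' u hu)

theorem PatchEq.symm {P Q : E → S} {x y : E} {U : Set E}
    (h : PatchEq P Q x y U) : PatchEq Q P y x U :=
  fun u hu => (h u hu).symm

theorem PatchEq.mono {P Q : E → S} {x y : E} {U V : Set E}
    (h : PatchEq P Q x y U) (hVU : V ⊆ U) : PatchEq P Q x y V :=
  fun u hu => h u (hVU hu)

/-- Moving the base points by `w` costs `‖w‖` of the agreement radius. -/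
theorem PatchEq.shift {P Q : E → S} {x y w : E} {r s : ℝ}
    (h : PatchEq P Q x y (closedBall 0 s)) (hw : r + ‖w‖ ≤ s) :
    PatchEq P Q (x + w) (y + w) (closedBall 0 r) := by
  intro u hu
  rw [mem_closedBall_zero_iff] at hu
  rw [add_assoc, add_assoc]
  apply h
  rw [mem_closedBall_zero_iff]
  linarith [norm_add_le w u]

/-- Every `U`-patch of `Q` occurs in `R`. -/
def PatchesOccur (U : Set E) (Q R : E → S) : Prop :=
  ∀ x : E, ∃ y : E, PatchEq Q R x y U

theorem PatchesOccur.refl (U : Set E) (Q : E → S) : PatchesOccur U Q Q :=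
  fun x => ⟨x, fun _ _ => rfl⟩

theorem PatchesOccur.trans {U : Set E} {P Q R : E → S}
    (h : PatchesOccur U P Q) (h' : PatchesOccur U Q R) : PatchesOccur U P R := by
  intro x
  obtain ⟨y, hy⟩ := h x
  obtain ⟨z, hz⟩ := h' y
  exact ⟨z, hy.trans hz⟩

theorem LIfrom.trans {P Q R : E → S} (h : LIfrom P Q) (h' : LIfrom Q R) : LIfrom P R :=
  fun U hU => PatchesOccur.trans (h U hU) (h' U hU)

/-- For an FLC pattern `P`, finitely many base points represent, up to small translations, all
patches of radius `r + 1` of patterns in the hull. Hence the set of representatives that occur in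
a pattern determines which patches of radius `r` occur. -/
theorem IsFLC.exists_finite_representatives [FiniteDimensional ℝ E] {P : E → S} (hP : IsFLC P)
    (r : ℝ) : ∃ T : Set E, T.Finite ∧ ∀ Q ∈ patternHull P, ∀ R : E → S,
      (∀ t ∈ T, (∃ x, PatchEq Q P x t (closedBall 0 (r + 1))) →
        ∃ x, PatchEq R P x t (closedBall 0 (r + 1))) →
      PatchesOccur (closedBall 0 r) Q R := by
  have : ProperSpace E := FiniteDimensional.proper ℝ E
  obtain ⟨K, hK, hKP⟩ := hP (closedBall 0 (r + 2)) (isCompact_closedBall _ _)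
  obtain ⟨T, -, hT, hKT⟩ := hK.finite_cover_balls (e := 1) one_pos
  refine ⟨T, hT, fun Q hQ R hQR x => ?_⟩
  obtain ⟨y, hy⟩ := hQ _ (isCompact_closedBall 0 (r + 2)) x
  obtain ⟨v, hvK, hv⟩ := hKP y
  obtain ⟨t, htT, hvt⟩ := mem_iUnion₂.1 (hKT hvK)
  have hw : ‖t - v‖ ≤ 1 := by
    rw [← dist_eq_norm, dist_comm]
    exact (mem_ball.1 hvt).le
  have hx := (hy.trans hv).shift (w := t - v) (r := r + 1) (by linarith)
  rw [add_sub_cancel] at hx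
  obtain ⟨z, hz⟩ := hQR t htT ⟨_, hx⟩
  have hxz := (hx.trans hz.symm).shift (w := v - t) (r := r) (by
    rw [norm_sub_rev]
    linarith)
  refine ⟨z + (v - t), ?_⟩
  have hcancel : x + (t - v) + (v - t) = x := by abel
  rwa [hcancel] at hxz

/-- For expansive `L`, every ball lies in a bounded set that is stable under thickening by `c`
followed by `L⁻¹`. -/
theorem IsExpansive.exists_stable_set {L : E ≃ₗ[ℝ] E} (hL : IsExpansive L) {c : ℝ} (hc : 0 ≤ c)
    {r : ℝ} (hr : 0 ≤ r) : ∃ (U : Set E) (s : ℝ), closedBall 0 r ⊆ U ∧ U ⊆ closedBall 0 s ∧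
      ∀ u ∈ U, ∀ b ∈ closedBall (0 : E) c, L.symm (u + b) ∈ U := by
  obtain ⟨C, hC, l, hl, hCl⟩ := hL
  have hl0 : 0 < l := one_pos.trans hl
  have hinv : ∀ (n : ℕ) (x : E), l ^ n * ‖(L.symm ^ n : E ≃ₗ[ℝ] E) x‖ ≤ ‖x‖ / C := by
    intro n x
    have h := hCl n ((L.symm ^ n : E ≃ₗ[ℝ] E) x)
    have hx : (L ^ n : E ≃ₗ[ℝ] E) ((L.symm ^ n : E ≃ₗ[ℝ] E) x) = x := by
      change (L ^ n * L⁻¹ ^ n : E ≃ₗ[ℝ] E) x = x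
      rw [inv_pow, mul_inv_cancel]
      rfl
    rw [hx] at h
    rw [le_div_iff₀ hC]
    linarith
  set s : ℝ := r / C + c / C / (l - 1) with hs
  have hl1 : 0 < l - 1 := sub_pos.2 hl
  have hsc : c / C ≤ s * (l - 1) := by
    rw [hs, add_mul, div_mul_cancel₀ _ hl1.ne']
    have : 0 ≤ r / C * (l - 1) := by positivity
    linarith
  have hsr : r / C ≤ s := by
    have : 0 ≤ c / C / (l - 1) := by positivity
    linarith
  refine ⟨{x | ∀ n : ℕ, l ^ n * ‖(L.symm ^ n : E ≃ₗ[ℝ] E) x‖ ≤ s}, s, ?_, ?_, ?_⟩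
  · intro x hx n
    rw [mem_closedBall_zero_iff] at hx
    exact (hinv n x).trans ((by gcongr : ‖x‖ / C ≤ r / C).trans hsr)
  · intro x hx
    have h := hx 0
    rw [mem_closedBall_zero_iff]
    simpa using h
  · intro u hu b hb n
    rw [mem_closedBall_zero_iff] at hb
    have hpow : (L.symm ^ n : E ≃ₗ[ℝ] E) (L.symm (u + b)) =
        (L.symm ^ (n + 1) : E ≃ₗ[ℝ] E) u + (L.symm ^ (n + 1) : E ≃ₗ[ℝ] E) b := by
      rw [← map_add, pow_succ]
      rfl
    have hb' : l ^ (n + 1) * ‖(L.symm ^ (n + 1) : E ≃ₗ[ℝ] E) b‖ ≤ c / C :=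
      (hinv (n + 1) b).trans (by gcongr)
    have hu' := hu (n + 1)
    have hnorm := mul_le_mul_of_nonneg_left
      (norm_add_le ((L.symm ^ (n + 1) : E ≃ₗ[ℝ] E) u) ((L.symm ^ (n + 1) : E ≃ₗ[ℝ] E) b))
      (pow_pos hl0 (n + 1)).le
    rw [hpow]
    refine le_of_mul_le_mul_left ?_ hl0
    rw [← mul_assoc, ← pow_succ']
    linarith

/-- A substitution does not destroy inclusions between the patch sets for a stable window. -/
theorem PatchesOccur.substMap {L : E ≃ₗ[ℝ] E} {Sub : (E → S) → (E → S)} {Ω : Set (E → S)} {c : ℝ}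
    (hSub : ∀ P ∈ distort L '' Ω, ∀ Q ∈ distort L '' Ω, ∀ x y : E,
      PatchEq P Q x y (closedBall 0 c) → Sub P x = Sub Q y)
    {U : Set E} (hU : ∀ u ∈ U, ∀ b ∈ closedBall (0 : E) c, L.symm (u + b) ∈ U)
    {Q R : E → S} (hQ : Q ∈ Ω) (hR : R ∈ Ω) (h : PatchesOccur U Q R) :
    PatchesOccur U (substMap L Sub Q) (substMap L Sub R) := by
  intro x
  obtain ⟨y, hy⟩ := h (L.symm x)
  refine ⟨L y, fun u hu => ?_⟩
  refine hSub _ (mem_image_of_mem _ hQ) _ (mem_image_of_mem _ hR) _ _ fun b hb => ?_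
  have h' := hy _ (hU u hu b hb)
  simpa only [distort, add_assoc, map_add, LinearEquiv.symm_apply_apply] using h'

/-- Every pattern of a hierarchy for an FLC expansive `L`-sub pattern `P` contains all patches
of `P`. -/
theorem LIfrom.of_hierarchy [FiniteDimensional ℝ E] {L : E ≃ₗ[ℝ] E} (hL : IsExpansive L)
    {P : E → S} (hFLC : IsFLC P) {Sub : (E → S) → (E → S)}
    (hSub : IsLDMapOn Sub (distort L '' patternHull P) (patternHull P))
    {Pseq : ℤ → E → S} (hmem : ∀ i : ℤ, Pseq i ∈ patternHull P)
    (hσ : ∀ i : ℤ, substMap L Sub (Pseq (i + 1)) = Pseq i) (hP0 : Pseq 0 = P) (j : ℤ) :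
    LIfrom P (Pseq j) := by
  have : ProperSpace E := FiniteDimensional.proper ℝ E
  obtain ⟨-, c, hc, hSub⟩ := hSub
  intro V hV
  obtain ⟨r, hr, hVr⟩ := hV.isBounded.subset_closedBall_lt 0 0
  obtain ⟨U, s, hrU, hUs, hU⟩ := hL.exists_stable_set hc hr.le
  suffices h : PatchesOccur U P (Pseq j) by
    intro x
    obtain ⟨y, hy⟩ := h x
    exact ⟨y, hy.mono (hVr.trans hrU)⟩
  have step : ∀ (k : ℕ) (i i' : ℤ), PatchesOccur U (Pseq i) (Pseq i') →
      PatchesOccur U (Pseq (i - k)) (Pseq (i' - k)) := by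
    intro k i i' h
    induction k with
    | zero => simpa using h
    | succ k ih =>
      have h' := PatchesOccur.substMap hSub hU (hmem _) (hmem _) ih
      have hi : ∀ a : ℤ, substMap L Sub (Pseq (a - k)) = Pseq (a - (k + 1 : ℕ)) := by
        intro a
        rw [← hσ (a - (k + 1 : ℕ))]
        congr 2
        push_cast
        ring
      rwa [hi, hi] at h'
  have h10 : PatchesOccur U (Pseq 1) (Pseq 0) := by
    intro x
    obtain ⟨y, hy⟩ := hmem 1 _ (isCompact_closedBall 0 s) x
    exact ⟨y, hP0 ▸ hy.mono hUs⟩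
  have hneg : ∀ k : ℕ, PatchesOccur U P (Pseq (-k)) := by
    intro k
    induction k with
    | zero => simpa [hP0] using PatchesOccur.refl U P
    | succ k ih =>
      have h' := step (k + 1) 1 0 h10
      have e1 : (1 : ℤ) - (k + 1 : ℕ) = -k := by push_cast; ring
      have e2 : (0 : ℤ) - (k + 1 : ℕ) = -(k + 1 : ℕ) := by ring
      rw [e1, e2] at h'
      exact ih.trans h'
  obtain ⟨T, hT, hTP⟩ := hFLC.exists_finite_representatives s
  obtain ⟨m, n, hmn, hj⟩ : ∃ m n : ℕ, PatchesOccur U (Pseq m) (Pseq n) ∧ m + j ≤ n := by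
    let A : ℕ → Set E := fun n => {t ∈ T | ∃ x, PatchEq (Pseq n) P x t (closedBall 0 (s + 1))}
    have hAfin : (range A).Finite :=
      hT.finite_subsets.subset (range_subset_iff.2 fun n => sep_subset _ _)
    have hgap : ∃ m n : ℕ, A (m * (j.toNat + 1)) = A (n * (j.toNat + 1)) ∧ m < n := by
      obtain ⟨m, -, n, -, hne, heq⟩ := infinite_univ.exists_ne_map_eq_of_mapsTo
        (f := fun k : ℕ => A (k * (j.toNat + 1))) (fun k _ => mem_range_self _) hAfin
      rcases hne.lt_or_gt with h | h
      · exact ⟨m, n, heq, h⟩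
      · exact ⟨n, m, heq.symm, h⟩
    obtain ⟨m, n, heq, hlt⟩ := hgap
    refine ⟨m * (j.toNat + 1), n * (j.toNat + 1), fun x => ?_, ?_⟩
    · obtain ⟨y, hy⟩ := hTP _ (hmem _) (Pseq (n * (j.toNat + 1) : ℕ))
        (fun t ht hx => (heq.subset (show t ∈ A (m * (j.toNat + 1)) from ⟨ht, hx⟩)).2) x
      exact ⟨y, hy.mono hUs⟩
    · have h1 : (m + 1) * (j.toNat + 1) ≤ n * (j.toNat + 1) := Nat.mul_le_mul_right _ hlt
      rw [add_mul, one_mul] at h1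
      omega
  obtain ⟨k, hk⟩ := Int.eq_ofNat_of_zero_le (sub_nonneg.2 hj)
  have h' := step (m + k) m n hmn
  have e1 : (m : ℤ) - (m + k : ℕ) = -k := by push_cast; ring
  have e2 : (n : ℤ) - (m + k : ℕ) = j := by push_cast; linarith
  rw [e1, e2] at h'
  exact (hneg k).trans h'

/-- Theorem: all patterns in a hierarchy of an FLC, well-separated, expansive `L`-sub
pattern are pairwise locally isomorphic, and each `P_i` is `L`-sub with predecessor
`P_{i+1}`. -/
theorem stmt6 [FiniteDimensional ℝ E] (L : E ≃ₗ[ℝ] E) (hL : IsExpansive L)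
    (P P' : E → S) (hFLC : IsFLC P) (hWS : WellSeparated P) (hsub : IsLSub L P P')
    (Sub : (E → S) → (E → S))
    (hSubLD : IsLDMapOn Sub (distort L '' patternHull P) (patternHull P))
    (hSubP : Sub (distort L P') = P)
    (Pseq : ℤ → E → S) (hmem : ∀ i : ℤ, Pseq i ∈ patternHull P)
    (hσ : ∀ i : ℤ, substMap L Sub (Pseq (i + 1)) = Pseq i)
    (hP0 : Pseq 0 = P) (hP1 : Pseq 1 = P') :
    (∀ i j : ℤ, LocIso (Pseq i) (Pseq j)) ∧
    ∀ i : ℤ, IsLSub L (Pseq i) (Pseq (i + 1)) := by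
  have hP : ∀ i, LIfrom P (Pseq i) := LIfrom.of_hierarchy hL hFLC hSubLD hmem hσ hP0
  refine ⟨fun i j => ⟨(hmem i).trans (hP j), (hmem j).trans (hP i)⟩,
    fun i => ⟨(hmem (i + 1)).trans (hP i), ?_⟩⟩
  obtain ⟨-, c, hc, hSub⟩ := hSubLD
  have hi := mem_image_of_mem (distort L) (hmem (i + 1))
  refine ⟨c, hc, fun x y hxy => ?_⟩
  rw [← hσ i]
  exact hSub _ hi _ hi x y hxy
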